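/- There exist universal constants c₁ > 0 and c₂ > 0 such that for every triangle in ℝ² (given by an affinely independent triple of points) with aspect ratio α = L²/S (where L is the longest side length and S the area) and minimum interior angle θ: c₁·α ≤ 1/θ ≤ c₂·α. -/

import Mathlib

open Real EuclideanGeometry

/-- The Euclidean area of the triangle `p₁ p₂ p₃` in the plane: half the
absolute value of the cross product of two edge vectors. -/
noncomputable def triArea (p₁ p₂ p₃ : EuclideanSpace ℝ (Fin 2)) : ℝ :=
  |(p₂ - p₁) 0 * (p₃ - p₁) 1 - (p₂ - p₁) 1 * (p₃ - p₁) 0| / 2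

theorem two_mul_triArea_eq_dist_mul_dist_mul_sin (p q r : EuclideanSpace ℝ (Fin 2)) :
    2 * triArea p q r = dist p q * dist p r * Real.sin (∠ q p r) := by
  have h := InnerProductGeometry.sin_angle_mul_norm_mul_norm (q - p) (r - p)
  have hdet : inner ℝ (q - p) (q - p) * inner ℝ (r - p) (r - p)
      - inner ℝ (q - p) (r - p) * inner ℝ (q - p) (r - p)
      = ((q - p) 0 * (r - p) 1 - (q - p) 1 * (r - p) 0) ^ 2 := by
    simp only [PiLp.inner_apply, Fin.sum_univ_two, RCLike.inner_apply, conj_trivial]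
    ring
  rw [hdet, Real.sqrt_sq_eq_abs] at h
  rw [dist_comm p q, dist_comm p r, dist_eq_norm, dist_eq_norm, EuclideanGeometry.angle,
    vsub_eq_sub, vsub_eq_sub, triArea, ← h]
  ring

theorem triArea_rotate (p q r : EuclideanSpace ℝ (Fin 2)) : triArea q r p = triArea p q r := by
  simp only [triArea, PiLp.sub_apply]
  congr 2
  ring

theorem triArea_swap (p q r : EuclideanSpace ℝ (Fin 2)) : triArea p r q = triArea p q r := by
  rw [triArea, triArea, ← abs_neg]
  congr 2
  ring

theorem two_div_pi_mul_le_sin_of_le_of_le_pi_sub {θ φ : ℝ} (hθ : 0 ≤ θ) (h₁ : θ ≤ φ)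
    (h₂ : θ ≤ π - φ) : 2 / π * θ ≤ Real.sin φ := by
  rcases le_total φ (π / 2) with h | h
  · refine le_trans ?_ (Real.mul_le_sin (hθ.trans h₁) h)
    gcongr
  · rw [← Real.sin_pi_sub]
    refine le_trans ?_ (Real.mul_le_sin (hθ.trans h₂) (by linarith))
    gcongr

/-- Among sides `a`, `b`, `c` satisfying the triangle inequalities, some side other than the
longest one has at least half the maximal length, so bounds on the pairwise products bound the
square of the maximum. -/
theorem sq_max_mul_le_of_forall_mul_mul_le {a b c s T : ℝ} (ha : 0 ≤ a) (hb : 0 ≤ b)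
    (hc : 0 ≤ c) (hs : 0 ≤ s) (hab : a ≤ b + c) (hbc : b ≤ c + a) (hca : c ≤ a + b)
    (h₁ : a * b * s ≤ T) (h₂ : b * c * s ≤ T) (h₃ : c * a * s ≤ T) :
    (max a (max b c)) ^ 2 * s ≤ 2 * T := by
  rcases max_choice b c with h | h <;> rcases max_choice a (max b c) with h' | h' <;>
    rw [h'] <;> try rw [h]
  all_goals
    first
    | nlinarith [mul_nonneg (mul_nonneg ha hs) (sub_nonneg.2 hab)]
    | nlinarith [mul_nonneg (mul_nonneg hb hs) (sub_nonneg.2 hbc)]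
    | nlinarith [mul_nonneg (mul_nonneg hc hs) (sub_nonneg.2 hca)]

/-- There are universal constants `c₁, c₂ > 0` such that for every triangle
with aspect ratio `α = L²/S` and minimum interior angle `θ`,
`c₁·α ≤ 1/θ ≤ c₂·α`. -/
theorem aspect_ratio_equiv_inv_min_angle :
    ∃ c₁ c₂ : ℝ, 0 < c₁ ∧ 0 < c₂ ∧
      ∀ p₁ p₂ p₃ : EuclideanSpace ℝ (Fin 2),
        AffineIndependent ℝ ![p₁, p₂, p₃] →
        ∀ S L α θ : ℝ, S = triArea p₁ p₂ p₃ →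
          L = max (dist p₁ p₂) (max (dist p₂ p₃) (dist p₃ p₁)) →
          α = L ^ 2 / S →
          θ = min (∠ p₂ p₁ p₃) (min (∠ p₁ p₂ p₃) (∠ p₁ p₃ p₂)) →
          c₁ * α ≤ 1 / θ ∧ 1 / θ ≤ c₂ * α := by
  refine ⟨1 / (2 * π), 1 / 2, by positivity, by norm_num, ?_⟩
  intro p₁ p₂ p₃ hp S L α θ hS hL hα hθ
  have hncol : ¬ Collinear ℝ {p₁, p₂, p₃} := affineIndependent_iff_not_collinear_set.1 hp
  have hne₁₂ : p₁ ≠ p₂ := ne₁₂_of_not_collinear hncol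
  have hne₁₃ : p₁ ≠ p₃ := ne₁₃_of_not_collinear hncol
  have hne₂₃ : p₂ ≠ p₃ := ne₂₃_of_not_collinear hncol
  have hd₁₂ : 0 < dist p₁ p₂ := dist_pos.2 hne₁₂
  have hd₂₃ : 0 < dist p₂ p₃ := dist_pos.2 hne₂₃
  have hd₃₁ : 0 < dist p₃ p₁ := dist_pos.2 hne₁₃.symm
  have hS₁ : 2 * S = dist p₁ p₂ * dist p₃ p₁ * Real.sin (∠ p₂ p₁ p₃) := by
    rw [hS, two_mul_triArea_eq_dist_mul_dist_mul_sin, dist_comm p₃ p₁]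
  have hS₂ : 2 * S = dist p₁ p₂ * dist p₂ p₃ * Real.sin (∠ p₁ p₂ p₃) := by
    rw [hS, ← triArea_rotate, ← triArea_swap, two_mul_triArea_eq_dist_mul_dist_mul_sin,
      dist_comm p₂ p₁]
  have hS₃ : 2 * S = dist p₂ p₃ * dist p₃ p₁ * Real.sin (∠ p₁ p₃ p₂) := by
    rw [hS, ← triArea_rotate, ← triArea_rotate, two_mul_triArea_eq_dist_mul_dist_mul_sin,
      dist_comm p₃ p₂]
    ring
  have hsin : 0 < Real.sin (∠ p₂ p₁ p₃) := by
    refine EuclideanGeometry.sin_pos_of_not_collinear ?_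
    rwa [Set.insert_comm]
  have hSpos : 0 < S := by
    have : 0 < dist p₁ p₂ * dist p₃ p₁ * Real.sin (∠ p₂ p₁ p₃) := by positivity
    linarith
  have hsum : ∠ p₂ p₁ p₃ + ∠ p₁ p₂ p₃ + ∠ p₁ p₃ p₂ = π := by
    have h := EuclideanGeometry.angle_add_angle_add_angle_eq_pi p₃ hne₁₂.symm
    rw [EuclideanGeometry.angle_comm p₂ p₃ p₁, EuclideanGeometry.angle_comm p₃ p₁ p₂] at h
    linarith
  have hθ₁ : θ ≤ ∠ p₂ p₁ p₃ := hθ ▸ min_le_left _ _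
  have hθ₂ : θ ≤ ∠ p₁ p₂ p₃ := hθ ▸ (min_le_right _ _).trans (min_le_left _ _)
  have hθ₃ : θ ≤ ∠ p₁ p₃ p₂ := hθ ▸ (min_le_right _ _).trans (min_le_right _ _)
  have hn₁ := EuclideanGeometry.angle_nonneg p₂ p₁ p₃
  have hn₂ := EuclideanGeometry.angle_nonneg p₁ p₂ p₃
  have hn₃ := EuclideanGeometry.angle_nonneg p₁ p₃ p₂
  have hθ₀ : 0 ≤ θ := hθ ▸ le_min hn₁ (le_min hn₂ hn₃)
  have hL₁ : dist p₁ p₂ ≤ L := hL ▸ le_max_left _ _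
  have hL₂ : dist p₂ p₃ ≤ L := hL ▸ (le_max_left _ _).trans (le_max_right _ _)
  have hL₃ : dist p₃ p₁ ≤ L := hL ▸ (le_max_right _ _).trans (le_max_right _ _)
  have hLpos : 0 < L := hd₁₂.trans_le hL₁
  have hupper : ∀ x y φ : ℝ, 0 ≤ x → 0 ≤ y → x ≤ L → y ≤ L → 0 ≤ φ →
      2 * S = x * y * Real.sin φ → 2 * S ≤ L ^ 2 * φ := by
    intro x y φ hx hy hxL hyL hφ h
    calc 2 * S = x * y * Real.sin φ := h
      _ ≤ x * y * φ := by gcongr; exact Real.sin_le hφ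
      _ ≤ L * L * φ := by gcongr
      _ = L ^ 2 * φ := by ring
  have hSθ : 2 * S ≤ L ^ 2 * θ := by
    have h₁ := hupper _ _ _ hd₁₂.le hd₃₁.le hL₁ hL₃ hn₁ hS₁
    have h₂ := hupper _ _ _ hd₁₂.le hd₂₃.le hL₁ hL₂ hn₂ hS₂
    have h₃ := hupper _ _ _ hd₂₃.le hd₃₁.le hL₂ hL₃ hn₃ hS₃
    rcases min_choice (∠ p₁ p₂ p₃) (∠ p₁ p₃ p₂) with h | h <;>
      rcases min_choice (∠ p₂ p₁ p₃) (min (∠ p₁ p₂ p₃) (∠ p₁ p₃ p₂)) with h' | h' <;>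
      rw [hθ, h'] <;> first | assumption | (rw [h]; assumption)
  have hθpos : 0 < θ := by
    by_contra! h
    nlinarith [sq_nonneg L]
  have hlower : L ^ 2 * (2 / π * θ) ≤ 2 * (2 * S) := by
    rw [hL]
    refine sq_max_mul_le_of_forall_mul_mul_le hd₁₂.le hd₂₃.le hd₃₁.le (by positivity)
      ?_ ?_ ?_ ?_ ?_ ?_
    · have := dist_triangle_right p₁ p₂ p₃
      rw [dist_comm p₁ p₃] at this
      linarith
    · have := dist_triangle_right p₂ p₃ p₁
      rw [dist_comm p₂ p₁] at this
      linarith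
    · have := dist_triangle_right p₃ p₁ p₂
      rw [dist_comm p₃ p₂] at this
      linarith
    · rw [hS₂]
      gcongr
      exact two_div_pi_mul_le_sin_of_le_of_le_pi_sub hθ₀ hθ₂ (by linarith)
    · rw [hS₃]
      gcongr
      exact two_div_pi_mul_le_sin_of_le_of_le_pi_sub hθ₀ hθ₃ (by linarith)
    · rw [hS₁, mul_comm (dist p₃ p₁)]
      gcongr
      exact two_div_pi_mul_le_sin_of_le_of_le_pi_sub hθ₀ hθ₁ (by linarith)
  have hπ := Real.pi_pos
  subst hα
  constructor
  · have h : L ^ 2 * θ ≤ 2 * π * S := by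
      have h' : L ^ 2 * (2 / π * θ) * π = 2 * (L ^ 2 * θ) := by field_simp
      nlinarith [mul_le_mul_of_nonneg_right hlower hπ.le]
    rw [div_mul_div_comm, one_mul, div_le_div_iff₀ (by positivity) hθpos]
    linarith
  · rw [div_mul_div_comm, one_mul, div_le_div_iff₀ hθpos (by positivity)]
    linarith
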